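/- Let 𝕏 ∈ ℝ^{n×p}, f ∈ ℝⁿ, ξ ∈ ℝⁿ, y = f + ξ, and λ > 0. Let β̂ be any solution of the LASSO problem min_{β∈ℝᵖ}( ‖y − 𝕏β‖² + 2λ|β|₁ ). If (1/n)‖𝕏ᵀξ‖_∞ ≤ λ/2, then ‖𝕏β̂ − f‖² ≤ min over S ⊆ {1,…,p} of [ min_{β∈ℝᵖ: supp(β)=S} ‖𝕏β − f‖² + 9|S|λ²/(4κ²(S,3)) ], with the convention a/0 = +∞ for a > 0. -/

import Mathlib

open MeasureTheory
open scoped ENNReal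

/-- The scaled Euclidean norm `‖u‖ = sqrt((1/n) ∑ u_i²)` on `ℝⁿ`. -/
noncomputable def scaledNorm {n : ℕ} (u : Fin n → ℝ) : ℝ :=
  Real.sqrt ((∑ i, u i ^ 2) / n)

/-- The squared Restricted Eigenvalue constant
`κ²(S,c₀) = min { ‖XΔ‖²/|Δ|₂² : Δ ≠ 0, |Δ_{Sᶜ}|₁ ≤ c₀ |Δ_S|₁ }`. -/
noncomputable def kappaSq {n p : ℕ} (X : Matrix (Fin n) (Fin p) ℝ)
    (S : Finset (Fin p)) (c₀ : ℝ) : ℝ :=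
  sInf {r | ∃ Δ : Fin p → ℝ, Δ ≠ 0 ∧ (∑ j ∈ Sᶜ, |Δ j|) ≤ c₀ * ∑ j ∈ S, |Δ j| ∧
    r = scaledNorm (X.mulVec Δ) ^ 2 / ∑ j, Δ j ^ 2}

open Matrix

lemma scaledNorm_sq {n : ℕ} (u : Fin n → ℝ) : scaledNorm u ^ 2 = (u ⬝ᵥ u) / n := by
  rw [scaledNorm, Real.sq_sqrt (div_nonneg (Finset.sum_nonneg fun i _ => sq_nonneg _)
    (Nat.cast_nonneg _))]
  simp only [dotProduct, sq]

lemma scaledNorm_add_sq {n : ℕ} (u v : Fin n → ℝ) :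
    scaledNorm (u + v) ^ 2 = scaledNorm u ^ 2 + 2 * ((u ⬝ᵥ v) / n) + scaledNorm v ^ 2 := by
  simp only [scaledNorm_sq, add_dotProduct, dotProduct_add, dotProduct_comm v u]
  ring

lemma nonneg_of_forall_mul_add_mul_sq_nonneg {a b : ℝ} (hb : 0 ≤ b)
    (h : ∀ t : ℝ, 0 < t → t ≤ 1 → 0 ≤ a * t + b * t ^ 2) : 0 ≤ a := by
  by_contra! ha
  have hd : 0 < b - a := by linarith
  have h1 := h (-a / (b - a)) (div_pos (by linarith) hd) ((div_le_one hd).2 (by linarith))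
  have h2 : a * (-a / (b - a)) + b * (-a / (b - a)) ^ 2 = a ^ 3 / (b - a) ^ 2 := by
    field_simp
    ring
  have h3 : a ^ 3 / (b - a) ^ 2 < 0 :=
    div_neg_of_neg_of_pos (Odd.pow_neg (by decide) ha) (by positivity)
  linarith

/-- First-order optimality of a LASSO solution, tested in the direction of a competitor. -/
lemma lasso_first_order {n p : ℕ} {X : Matrix (Fin n) (Fin p) ℝ} {y : Fin n → ℝ} {lam : ℝ}
    (hlam : 0 ≤ lam) {βhat : Fin p → ℝ}
    (hmin : ∀ b : Fin p → ℝ,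
      scaledNorm (y - X.mulVec βhat) ^ 2 + 2 * lam * ∑ j, |βhat j|
        ≤ scaledNorm (y - X.mulVec b) ^ 2 + 2 * lam * ∑ j, |b j|) (β : Fin p → ℝ) :
    0 ≤ 2 * (((y - X *ᵥ βhat) ⬝ᵥ (X *ᵥ (βhat - β))) / n)
      + 2 * lam * (∑ j, |β j| - ∑ j, |βhat j|) := by
  refine nonneg_of_forall_mul_add_mul_sq_nonneg (sq_nonneg (scaledNorm (X *ᵥ (βhat - β))))
    fun t ht ht1 => ?_
  have h := hmin (βhat - t • (βhat - β))
  have hres : y - X *ᵥ (βhat - t • (βhat - β))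
      = (y - X *ᵥ βhat) + t • (X *ᵥ (βhat - β)) := by
    rw [mulVec_sub, mulVec_smul]
    abel
  have hl1 : ∑ j, |(βhat - t • (βhat - β)) j|
      ≤ (1 - t) * ∑ j, |βhat j| + t * ∑ j, |β j| := by
    rw [Finset.mul_sum, Finset.mul_sum, ← Finset.sum_add_distrib]
    refine Finset.sum_le_sum fun j _ => ?_
    have hj : (βhat - t • (βhat - β)) j = (1 - t) * βhat j + t * β j := by
      simp only [Pi.sub_apply, Pi.smul_apply, smul_eq_mul]
      ring
    rw [hj]
    refine (abs_add_le _ _).trans_eq ?_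
    rw [abs_mul, abs_mul, abs_of_nonneg (sub_nonneg.2 ht1), abs_of_pos ht]
  rw [hres, scaledNorm_add_sq] at h
  have hsq : scaledNorm (t • (X *ᵥ (βhat - β))) ^ 2
      = t ^ 2 * scaledNorm (X *ᵥ (βhat - β)) ^ 2 := by
    simp only [scaledNorm_sq, smul_dotProduct, dotProduct_smul, smul_eq_mul]
    ring
  rw [hsq, dotProduct_smul, smul_eq_mul, mul_div_assoc] at h
  have h2 := mul_le_mul_of_nonneg_left hl1 (by linarith : 0 ≤ 2 * lam)
  linarith

lemma two_mul_noise_dotProduct_le {n p : ℕ} {X : Matrix (Fin n) (Fin p) ℝ} {ξ : Fin n → ℝ}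
    {lam : ℝ} (hevent : ∀ j : Fin p, (1 / n) * |X.transpose.mulVec ξ j| ≤ lam / 2)
    (Δ : Fin p → ℝ) : 2 * ((ξ ⬝ᵥ (X *ᵥ Δ)) / n) ≤ lam * ∑ j, |Δ j| := by
  have hdual : (ξ ⬝ᵥ (X *ᵥ Δ)) / n = ∑ j, (1 / n) * ((Xᵀ *ᵥ ξ) j * Δ j) := by
    rw [dotProduct_mulVec, ← mulVec_transpose, ← Finset.mul_sum, dotProduct]
    ring
  rw [hdual, Finset.mul_sum, Finset.mul_sum]
  refine Finset.sum_le_sum fun j _ => ?_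
  have h1 : (1 / n : ℝ) * ((Xᵀ *ᵥ ξ) j * Δ j) ≤ (1 / n) * |(Xᵀ *ᵥ ξ) j| * |Δ j| := by
    rw [mul_assoc, ← abs_mul]
    exact mul_le_mul_of_nonneg_left (le_abs_self _) (by positivity)
  have h2 := mul_le_mul_of_nonneg_right (hevent j) (abs_nonneg (Δ j))
  linarith

lemma sum_abs_sub_sum_abs_le {p : ℕ} {S : Finset (Fin p)} {β : Fin p → ℝ}
    (hβ : ∀ j ∈ Sᶜ, β j = 0) (b : Fin p → ℝ) :
    ∑ j, |β j| - ∑ j, |b j| ≤ ∑ j ∈ S, |(b - β) j| - ∑ j ∈ Sᶜ, |(b - β) j| := by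
  rw [← Finset.sum_add_sum_compl S fun j => |β j|, ← Finset.sum_add_sum_compl S fun j => |b j|]
  have h1 : ∑ j ∈ Sᶜ, |β j| = 0 := Finset.sum_eq_zero fun j hj => by rw [hβ j hj, abs_zero]
  have h2 : ∑ j ∈ Sᶜ, |(b - β) j| = ∑ j ∈ Sᶜ, |b j| :=
    Finset.sum_congr rfl fun j hj => by rw [Pi.sub_apply, hβ j hj, sub_zero]
  have h3 : ∑ j ∈ S, |β j| ≤ ∑ j ∈ S, |b j| + ∑ j ∈ S, |(b - β) j| := by
    rw [← Finset.sum_add_distrib]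
    refine Finset.sum_le_sum fun j _ => ?_
    have h := abs_sub_abs_le_abs_sub (β j) (b j)
    rw [abs_sub_comm] at h
    rw [Pi.sub_apply]
    linarith
  linarith

lemma kappaSq_mul_sum_sq_le {n p : ℕ} (X : Matrix (Fin n) (Fin p) ℝ) {S : Finset (Fin p)}
    {c₀ : ℝ} {Δ : Fin p → ℝ} (hΔ : ∑ j ∈ Sᶜ, |Δ j| ≤ c₀ * ∑ j ∈ S, |Δ j|) :
    kappaSq X S c₀ * ∑ j, Δ j ^ 2 ≤ scaledNorm (X *ᵥ Δ) ^ 2 := by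
  rcases eq_or_ne Δ 0 with rfl | h0
  · simpa using sq_nonneg _
  have hpos : 0 < ∑ j, Δ j ^ 2 := by
    obtain ⟨j, hj⟩ := Function.ne_iff.1 h0
    exact Finset.sum_pos' (fun _ _ => sq_nonneg _) ⟨j, Finset.mem_univ j, sq_pos_of_ne_zero hj⟩
  rw [← le_div_iff₀ hpos]
  refine csInf_le ⟨0, ?_⟩ ⟨Δ, h0, hΔ, rfl⟩
  rintro _ ⟨Δ', -, -, rfl⟩
  exact div_nonneg (sq_nonneg _) (Finset.sum_nonneg fun _ _ => sq_nonneg _)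

lemma sq_sum_abs_le_card_mul {p : ℕ} (S : Finset (Fin p)) (Δ : Fin p → ℝ) :
    (∑ j ∈ S, |Δ j|) ^ 2 ≤ S.card * ∑ j, Δ j ^ 2 := by
  refine sq_sum_le_card_mul_sum_sq.trans (mul_le_mul_of_nonneg_left ?_ (Nat.cast_nonneg _))
  simp only [sq_abs]
  exact Finset.sum_le_sum_of_subset_of_nonneg (Finset.subset_univ _) fun _ _ _ => sq_nonneg _

/-- The bound of the oracle inequality before the restricted eigenvalue constant is used. -/
lemma lasso_basic_inequality {n p : ℕ} {X : Matrix (Fin n) (Fin p) ℝ} {f ξ : Fin n → ℝ}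
    {lam : ℝ} (hlam : 0 ≤ lam) {βhat : Fin p → ℝ}
    (hmin : ∀ b : Fin p → ℝ,
      scaledNorm (f + ξ - X.mulVec βhat) ^ 2 + 2 * lam * ∑ j, |βhat j|
        ≤ scaledNorm (f + ξ - X.mulVec b) ^ 2 + 2 * lam * ∑ j, |b j|)
    (hevent : ∀ j : Fin p, (1 / n) * |X.transpose.mulVec ξ j| ≤ lam / 2)
    {S : Finset (Fin p)} {β : Fin p → ℝ} (hβ : ∀ j ∈ Sᶜ, β j = 0) :
    scaledNorm (X *ᵥ βhat - f) ^ 2 + scaledNorm (X *ᵥ (βhat - β)) ^ 2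
      ≤ scaledNorm (X *ᵥ β - f) ^ 2
        + lam * (3 * ∑ j ∈ S, |(βhat - β) j| - ∑ j ∈ Sᶜ, |(βhat - β) j|) := by
  have hopt := lasso_first_order hlam hmin β
  have hnoise := two_mul_noise_dotProduct_le hevent (βhat - β)
  have hl1 := mul_le_mul_of_nonneg_left (sum_abs_sub_sum_abs_le hβ βhat)
    (by linarith : 0 ≤ 2 * lam)
  rw [← Finset.sum_add_sum_compl S fun j => |(βhat - β) j|] at hnoise
  have hu : X *ᵥ β - f = (X *ᵥ βhat - f) + -(X *ᵥ (βhat - β)) := by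
    rw [mulVec_sub]
    abel
  have hr : f + ξ - X *ᵥ βhat = ξ - (X *ᵥ βhat - f) := by abel
  rw [hr, sub_dotProduct, sub_div] at hopt
  have hneg : scaledNorm (-(X *ᵥ (βhat - β))) ^ 2 = scaledNorm (X *ᵥ (βhat - β)) ^ 2 := by
    simp only [scaledNorm_sq, neg_dotProduct_neg]
  rw [hu, scaledNorm_add_sq, hneg, dotProduct_neg, neg_div]
  linarith

/-- Sharp oracle inequality for the LASSO on the event `(1/n)‖Xᵀξ‖_∞ ≤ λ/2`.
The right-hand side (including the convention `a/0 = +∞`) is expressed in `ℝ≥0∞`. -/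
theorem stmt7 (n p : ℕ) (hn : 0 < n)
    (X : Matrix (Fin n) (Fin p) ℝ) (f ξ y : Fin n → ℝ) (hy : y = f + ξ)
    (lam : ℝ) (hlam : 0 < lam)
    (βhat : Fin p → ℝ)
    (hmin : ∀ b : Fin p → ℝ,
      scaledNorm (y - X.mulVec βhat) ^ 2 + 2 * lam * ∑ j, |βhat j|
        ≤ scaledNorm (y - X.mulVec b) ^ 2 + 2 * lam * ∑ j, |b j|)
    (hevent : ∀ j : Fin p, (1 / n) * |X.transpose.mulVec ξ j| ≤ lam / 2) :
    ENNReal.ofReal (scaledNorm (X.mulVec βhat - f) ^ 2)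
      ≤ ⨅ (S : Finset (Fin p)) (β : Fin p → ℝ) (_ : Function.support β = ↑S),
          (ENNReal.ofReal (scaledNorm (X.mulVec β - f) ^ 2) +
            ENNReal.ofReal (9 * S.card * lam ^ 2) /
              ENNReal.ofReal (4 * kappaSq X S 3)) := by
  subst hy
  refine le_iInf fun S => le_iInf fun β => le_iInf fun hS => ?_
  have hβ : ∀ j ∈ Sᶜ, β j = 0 := fun j hj => by
    rw [Finset.mem_compl, ← Finset.mem_coe, ← hS] at hj
    exact Function.notMem_support.1 hj
  have hbasic := lasso_basic_inequality hlam.le hmin hevent hβ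
  have hXsq := sq_nonneg (scaledNorm (X *ᵥ (βhat - β)))
  by_cases hcone : ∑ j ∈ Sᶜ, |(βhat - β) j| ≤ 3 * ∑ j ∈ S, |(βhat - β) j|
  swap
  · refine le_add_right (ENNReal.ofReal_le_ofReal ?_)
    have := mul_nonneg hlam.le (sub_nonneg.2 (not_le.1 hcone).le)
    linarith
  rcases S.eq_empty_or_nonempty with rfl | hne
  · refine le_add_right (ENNReal.ofReal_le_ofReal ?_)
    have := mul_nonneg hlam.le
      (Finset.sum_nonneg fun j (_ : j ∈ (∅ : Finset (Fin p))ᶜ) => abs_nonneg ((βhat - β) j))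
    rw [Finset.sum_empty] at hbasic
    linarith
  have hcard : (0 : ℝ) < S.card := Nat.cast_pos.2 hne.card_pos
  rcases le_or_gt (kappaSq X S 3) 0 with hκ | hκ
  · rw [ENNReal.ofReal_of_nonpos (by linarith : 4 * kappaSq X S 3 ≤ 0),
      ENNReal.div_zero (ENNReal.ofReal_pos.2 (by positivity)).ne', add_top]
    exact le_top
  rw [← ENNReal.ofReal_div_of_pos (by positivity),
    ← ENNReal.ofReal_add (sq_nonneg _) (by positivity)]
  refine ENNReal.ofReal_le_ofReal ?_
  have hRE := kappaSq_mul_sum_sq_le X hcone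
  have hCS := sq_sum_abs_le_card_mul S (βhat - β)
  have hcompl : 0 ≤ lam * ∑ j ∈ Sᶜ, |(βhat - β) j| :=
    mul_nonneg hlam.le (Finset.sum_nonneg fun _ _ => abs_nonneg _)
  set A := ∑ j ∈ S, |(βhat - β) j|
  set κ := kappaSq X S 3
  set s := (S.card : ℝ)
  have hA : κ * A ^ 2 / s ≤ scaledNorm (X *ᵥ (βhat - β)) ^ 2 := by
    rw [div_le_iff₀ hcard]
    nlinarith [mul_le_mul_of_nonneg_left hCS hκ.le, mul_le_mul_of_nonneg_left hRE hcard.le]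
  have hamgm : 3 * lam * A ≤ 9 * s * lam ^ 2 / (4 * κ) + κ * A ^ 2 / s := by
    have h : 9 * s * lam ^ 2 / (4 * κ) + κ * A ^ 2 / s - 3 * lam * A
        = (3 * s * lam - 2 * κ * A) ^ 2 / (4 * κ * s) := by
      field_simp
      ring
    have h' : 0 ≤ (3 * s * lam - 2 * κ * A) ^ 2 / (4 * κ * s) := by positivity
    linarith
  linarith
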